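/- arXiv:2604.14877 — 3 statements merged into one kernel-verified Lean document; each statement's English description precedes it below -/
import Mathlib

section
/- For natural numbers n, c₁, c₂, k₁, k₂ with c₁ ≤ c₂ ≤ n and k₁ ≤ k₂ ≤ n, joint monotonicity holds: 1 - C(n-c₁, k₁)/C(n, k₁) ≤ 1 - C(n-c₂, k₂)/C(n, k₂). -/
theorem choose_mul_choose_le_choose_mul_choose {m n k l : ℕ} (hmn : m ≤ n) (hkl : k ≤ l) :
    m.choose l * n.choose k ≤ m.choose k * n.choose l := by
  refine Nat.le_of_mul_le_mul_right ?_ (Nat.choose_pos hkl)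
  calc m.choose l * n.choose k * l.choose k
      = m.choose l * l.choose k * n.choose k := by ring
    _ = m.choose k * (m - k).choose (l - k) * n.choose k := by rw [Nat.choose_mul hkl]
    _ ≤ m.choose k * (n - k).choose (l - k) * n.choose k := by
        have h := Nat.choose_le_choose (l - k) (Nat.sub_le_sub_right hmn k)
        gcongr
    _ = m.choose k * (n.choose l * l.choose k) := by rw [Nat.choose_mul hkl]; ring
    _ = m.choose k * n.choose l * l.choose k := by ring

/-- Joint monotonicity of the pass@k estimator in both the success count `c`
and the sampling budget `k` (Proposition 1 of the paper). -/
theorem passk_estimator_mono_joint (n c₁ c₂ k₁ k₂ : ℕ)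
    (hc : c₁ ≤ c₂) (hc₂ : c₂ ≤ n) (hk : k₁ ≤ k₂) (hk₂ : k₂ ≤ n) :
    1 - ((n - c₁).choose k₁ : ℝ) / (n.choose k₁ : ℝ) ≤
      1 - ((n - c₂).choose k₂ : ℝ) / (n.choose k₂ : ℝ) := by
  have h₁ : (0 : ℝ) < n.choose k₁ := by exact_mod_cast Nat.choose_pos (hk.trans hk₂)
  have h₂ : (0 : ℝ) < n.choose k₂ := by exact_mod_cast Nat.choose_pos hk₂
  refine sub_le_sub_left ((div_le_div_iff₀ h₂ h₁).2 ?_) 1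
  exact_mod_cast (choose_mul_choose_le_choose_mul_choose (Nat.sub_le n c₂) hk).trans
    (Nat.mul_le_mul_right _ (Nat.choose_le_choose k₁ (Nat.sub_le_sub_left hc n)))
end

section
/- Fix a real number p ∈ [0, 1] and natural numbers n, k with 1 ≤ k ≤ n. If C is a binomial random variable with parameters n and p, then the expected value of the pass@k estimator is the true pass@k probability: E[1 - C(n-C, k)/C(n, k)] = 1 - (1-p)^k, where the expectation is the sum over c = 0, …, n of C(n, c) p^c (1-p)^{n-c} · (1 - C(n-c, k)/C(n, k)). -/
open Finset

/-- The binomial theorem weighted by the number of `k`-subsets of the complement. -/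
theorem sum_choose_mul_pow_mul_choose_sub {R : Type*} [CommSemiring R] (x y : R)
    {n k : ℕ} (hkn : k ≤ n) :
    ∑ c ∈ Finset.range (n + 1),
        (n.choose c : R) * x ^ c * y ^ (n - c) * ((n - c).choose k : R)
      = (n.choose k : R) * y ^ k * (x + y) ^ (n - k) := by
  rw [add_pow, Finset.mul_sum]
  symm
  refine Finset.sum_subset_zero_on_sdiff (Finset.range_mono (by omega)) ?_ ?_
  · intro c hc
    simp only [Finset.mem_sdiff, Finset.mem_range] at hc
    rw [Nat.choose_eq_zero_of_lt (show n - c < k by omega)]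
    simp
  · intro c hc
    have hck : c ≤ n - k := Nat.lt_succ_iff.mp (Finset.mem_range.mp hc)
    have hchoose : n.choose c * (n - c).choose k = n.choose k * (n - k).choose c := by
      rw [← Nat.choose_symm (hck.trans (Nat.sub_le n k)), Nat.choose_mul (by omega),
        ← Nat.choose_symm hck, Nat.sub_right_comm]
    have hpow : y ^ (n - c) = y ^ k * y ^ (n - k - c) := by
      rw [← pow_add]
      congr 1
      omega
    calc
      (n.choose k : R) * y ^ k * (x ^ c * y ^ (n - k - c) * ((n - k).choose c : R))
          = ((n.choose k * (n - k).choose c : ℕ) : R) * x ^ c * (y ^ k * y ^ (n - k - c)) := by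
        push_cast
        ring
      _ = (n.choose c : R) * x ^ c * y ^ (n - c) * ((n - c).choose k : R) := by
        rw [← hchoose, hpow]
        push_cast
        ring

/-- Unbiasedness of the hypergeometric pass@k estimator: if the success count
is Binomial(n, p), the expected value of `1 - C(n-c,k)/C(n,k)` is the true
pass@k probability `1 - (1-p)^k`. -/
theorem passk_estimator_unbiased (p : ℝ) (hp0 : 0 ≤ p) (hp1 : p ≤ 1)
    (n k : ℕ) (hk1 : 1 ≤ k) (hkn : k ≤ n) :
    ∑ c ∈ Finset.range (n + 1),
        (n.choose c : ℝ) * p ^ c * (1 - p) ^ (n - c) *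
          (1 - ((n - c).choose k : ℝ) / (n.choose k : ℝ))
      = 1 - (1 - p) ^ k := by
  have hne : (n.choose k : ℝ) ≠ 0 := by exact_mod_cast (Nat.choose_pos hkn).ne'
  have htotal : ∑ c ∈ Finset.range (n + 1), (n.choose c : ℝ) * p ^ c * (1 - p) ^ (n - c) = 1 := by
    simpa using sum_choose_mul_pow_mul_choose_sub p (1 - p) (Nat.zero_le n)
  have hweighted := sum_choose_mul_pow_mul_choose_sub p (1 - p) hkn
  rw [add_sub_cancel, one_pow, mul_one] at hweighted
  simp only [mul_sub, mul_one, ← mul_div_assoc]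
  rw [Finset.sum_sub_distrib, htotal, ← Finset.sum_div, hweighted, mul_div_cancel_left₀ _ hne]
end

section
/- Let n, c, n', k be natural numbers with c ≤ n and k ≤ n' ≤ n. If a uniformly random n'-element subset is drawn from a ground set of n trials containing c successes, and c' denotes the (random) number of successes it contains, then the expected value of the subsample pass@k estimator equals the full-sample estimator: E[1 - C(n'-c', k)/C(n', k)] = 1 - C(n-c, k)/C(n, k), where the expectation is taken over the hypergeometric distribution of c', i.e., Pr[c' = j] = C(c, j)·C(n-c, n'-j)/C(n, n'). -/
open Finset

theorem sum_range_choose_mul_choose (a b m : ℕ) :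
    ∑ j ∈ Finset.range (m + 1), a.choose j * b.choose (m - j) = (a + b).choose m := by
  rw [Nat.add_choose_eq, Finset.Nat.sum_antidiagonal_eq_sum_range_succ_mk]

theorem sum_range_choose_mul_choose_mul_choose {m k : ℕ} (a b : ℕ) (hk : k ≤ m) :
    ∑ j ∈ Finset.range (m + 1), a.choose j * b.choose (m - j) * (m - j).choose k
      = b.choose k * (a + b - k).choose (m - k) := by
  rcases lt_or_ge b k with hb | hb
  · rw [Nat.choose_eq_zero_of_lt hb, zero_mul]
    refine Finset.sum_eq_zero fun j _ => ?_
    rcases lt_or_ge (m - j) k with h | h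
    · rw [Nat.choose_eq_zero_of_lt h, mul_zero]
    · rw [Nat.choose_eq_zero_of_lt (hb.trans_le h), mul_zero, zero_mul]
  · rw [Nat.add_sub_assoc hb, ← sum_range_choose_mul_choose, Finset.mul_sum]
    symm
    refine Finset.sum_subset_zero_on_sdiff
      (Finset.range_subset_range.2 (by omega)) (fun j hj => ?_) (fun j hj => ?_)
    · simp only [Finset.mem_sdiff, Finset.mem_range] at hj
      rw [Nat.choose_eq_zero_of_lt (show m - j < k by omega), mul_zero]
    · have hj' : k ≤ m - j := by
        have := Finset.mem_range.1 hj
        omega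
      rw [mul_assoc, Nat.choose_mul hj', Nat.sub_right_comm]
      ring

/-- Consistency of the pass@k estimator under uniform subsampling: if `c'`
is the (hypergeometric) number of successes in a uniformly random
`n'`-element subsample of `n` trials containing `c` successes, then the
expected subsample estimator equals the full-sample estimator. -/
theorem passk_estimator_subsample_consistent (n c n' k : ℕ)
    (hc : c ≤ n) (hk : k ≤ n') (hn' : n' ≤ n) :
    ∑ j ∈ Finset.range (n' + 1),
        ((c.choose j * (n - c).choose (n' - j) : ℕ) : ℝ) / (n.choose n' : ℝ) *
          (1 - ((n' - j).choose k : ℝ) / (n'.choose k : ℝ))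
      = 1 - ((n - c).choose k : ℝ) / (n.choose k : ℝ) := by
  have hcn : c + (n - c) = n := Nat.add_sub_cancel' hc
  have hn0 : (n.choose n' : ℝ) ≠ 0 := mod_cast (Nat.choose_pos hn').ne'
  have hk0 : (n'.choose k : ℝ) ≠ 0 := mod_cast (Nat.choose_pos hk).ne'
  have hnk0 : (n.choose k : ℝ) ≠ 0 := mod_cast (Nat.choose_pos (hk.trans hn')).ne'
  have total : ∑ j ∈ Finset.range (n' + 1), ((c.choose j * (n - c).choose (n' - j) : ℕ) : ℝ)
      = n.choose n' := by
    rw [← Nat.cast_sum, sum_range_choose_mul_choose, hcn]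
  have weighted : ∑ j ∈ Finset.range (n' + 1),
      ((c.choose j * (n - c).choose (n' - j) : ℕ) : ℝ) * ((n' - j).choose k : ℝ)
      = (n - c).choose k * (n - k).choose (n' - k) := by
    have h := sum_range_choose_mul_choose_mul_choose c (n - c) hk
    rw [hcn] at h
    exact_mod_cast h
  have trinomial : (n.choose n' : ℝ) * n'.choose k = n.choose k * (n - k).choose (n' - k) :=
    mod_cast Nat.choose_mul hk
  calc
    _ = (∑ j ∈ Finset.range (n' + 1), ((c.choose j * (n - c).choose (n' - j) : ℕ) : ℝ))
          / n.choose n' -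
        (∑ j ∈ Finset.range (n' + 1),
          ((c.choose j * (n - c).choose (n' - j) : ℕ) : ℝ) * ((n' - j).choose k : ℝ))
          / (n.choose n' * n'.choose k) := by
      rw [Finset.sum_div, Finset.sum_div, ← Finset.sum_sub_distrib]
      refine Finset.sum_congr rfl fun j _ => ?_
      field_simp
    _ = _ := by
      rw [total, weighted, div_self hn0, sub_right_inj,
        div_eq_div_iff (mul_ne_zero hn0 hk0) hnk0, trinomial]
      ring
end
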